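/- arXiv:2506.18113 — 8 statements merged into one kernel-verified Lean document; each statement's English description precedes it below -/
import Mathlib

section
/- Let d ≥ 2 be an integer and let p be a prime with p ≡ 1 (mod 4) and p > (d+1)!. Then there exist d+2 polynomials f_1, …, f_d, g, h ∈ 𝔽_p[t] such that: (identity) f_1² + ⋯ + f_d² = g·h in 𝔽_p[t]; (degree) deg f_1 = ⋯ = deg f_d = d, deg g = d−1, and deg h = d+1; (independence) the d+2 polynomials f_1, …, f_d, g, h are linearly independent over 𝔽_p; and (vanish) the coefficient of t¹ in each of f_1, …, f_d, h is zero. -/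
open Polynomial in
/-- Householder reflection of a family of polynomials. -/
noncomputable def refl2 {K : Type*} [Field K] {d : ℕ} (u : Fin d → K) (f : Fin d → K[X]) (k : Fin d) :
    K[X] := f k - (2 * u k / ∑ j, u j ^ 2) • ∑ j, u j • f j

open Polynomial in
theorem refl2_sq {K : Type*} [Field K] {d : ℕ} (u : Fin d → K) (f : Fin d → K[X])
    (hN : ∑ j, u j ^ 2 ≠ 0) : ∑ k, refl2 u f k ^ 2 = ∑ k, f k ^ 2 := by
  unfold refl2
  set N := ∑ j, u j ^ 2 with hNd
  set F := ∑ j, u j • f j with hF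
  have h1 : ∀ k, (f k - (2 * u k / N) • F) ^ 2
      = f k ^ 2 - (C (4 / N) * F) * (u k • f k) + (C (4 / N ^ 2) * F ^ 2) * C (u k ^ 2) := by
    intro k
    simp only [smul_eq_C_mul]
    have e1 : (C (2 * u k / N) : K[X]) = C (2 / N) * C (u k) := by
      rw [← C_mul]; congr 1; ring
    have e2 : (C (4 / N) : K[X]) = 2 * C (2 / N) := by
      rw [← C_ofNat, ← C_mul]; congr 1; ring
    have e3 : (C (4 / N ^ 2) : K[X]) = C (2 / N) ^ 2 := by
      rw [← C_pow]; congr 1; ring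
    rw [e1, e2, e3, C_pow]; ring
  simp only [h1, Finset.sum_add_distrib, Finset.sum_sub_distrib, ← Finset.mul_sum]
  rw [← hF, ← map_sum, ← hNd]
  have : (C (4 / N) : K[X]) = C (4 / N ^ 2) * C N := by
    rw [← C_mul]; congr 1; field_simp
  rw [this]; ring

open Polynomial in
theorem refl2_indep {K : Type*} [Field K] {d : ℕ} (u : Fin d → K) (f : Fin d → K[X]) (g h : K[X])
    (hN : ∑ j, u j ^ 2 ≠ 0)
    (H : ∀ (c : Fin d → K) (a b : K),
        (∑ i, c i • f i) + a • g + b • h = 0 → (∀ i, c i = 0) ∧ a = 0 ∧ b = 0) :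
    ∀ (c : Fin d → K) (a b : K),
        (∑ i, c i • refl2 u f i) + a • g + b • h = 0 → (∀ i, c i = 0) ∧ a = 0 ∧ b = 0 := by
  intro c a b hc
  set N := ∑ j, u j ^ 2 with hNd
  set S := ∑ j, c j * u j with hS
  have key : ∑ i, c i • refl2 u f i = ∑ i, (c i - 2 * S / N * u i) • f i := by
    unfold refl2
    rw [← hNd]
    simp only [smul_sub, sub_smul, Finset.sum_sub_distrib, smul_smul]
    congr 1
    rw [← Finset.sum_smul]
    have : ∑ i, c i * (2 * u i / N) = 2 * S / N := by
      rw [hS, Finset.mul_sum, Finset.sum_div]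
      exact Finset.sum_congr rfl fun i _ => by ring
    rw [this, Finset.smul_sum]
    simp only [smul_smul]
  rw [key] at hc
  obtain ⟨h1, h2, h3⟩ := H _ a b hc
  refine ⟨?_, h2, h3⟩
  have h4 : ∑ i, (c i - 2 * S / N * u i) * u i = 0 := by simp [h1]
  have h5 : ∑ i, (c i - 2 * S / N * u i) * u i = S - 2 * S / N * N := by
    simp only [sub_mul, Finset.sum_sub_distrib]
    congr 1
    generalize 2 * S / N = z
    rw [hNd, Finset.mul_sum]
    exact Finset.sum_congr rfl fun i _ => by ring
  have h6 : S = 0 := by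
    rw [h5, div_mul_cancel₀ _ hN] at h4
    linear_combination -h4
  intro i
  have := h1 i
  simpa [h6] using this

open Polynomial in
/-- The base family. -/
noncomputable def base2 {K : Type*} [Field K] (n : ℕ) (I m : K) : Fin (n + 2) → K[X] :=
  Fin.cons (X ^ (n + 2) - C (m / 2)) (Fin.cons (C (I * m / 2))
    (fun k : Fin n => X ^ ((k : ℕ) + 2) + C I * X ^ ((k.rev : ℕ) + 2)))

open Polynomial in
theorem base2_sq {K : Type*} [Field K] (n : ℕ) (I m : K) (hI : I ^ 2 = -1) (h2 : (2 : K) ≠ 0) 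
    (hm : m = 1 + 2 * I * n) :
    ∑ k, base2 n I m k ^ 2
      = (C (m - 1) + ∑ k ∈ Finset.range (n + 2), X ^ k) * (X ^ (n + 3) - X ^ (n + 2)) := by
  unfold base2
  rw [Fin.sum_univ_succ, Fin.sum_univ_succ]
  simp only [Fin.cons_zero, Fin.cons_succ]
  have hIC : (C I : K[X]) ^ 2 = -1 := by rw [← C_pow, hI]; simp
  have e : ∀ k : Fin n, (X ^ ((k : ℕ) + 2) + C I * X ^ ((k.rev : ℕ) + 2) : K[X]) ^ 2
      = (X ^ ((k : ℕ) + 2)) ^ 2 - (X ^ ((k.rev : ℕ) + 2)) ^ 2 + 2 * C I * X ^ (n + 3) := by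
    intro k
    have : (X : K[X]) ^ (n + 3) = X ^ ((k : ℕ) + 2) * X ^ ((k.rev : ℕ) + 2) := by
      rw [← pow_add]; congr 1; rw [Fin.val_rev]; omega
    rw [this]
    linear_combination (X ^ ((k.rev : ℕ) + 2)) ^ 2 * hIC
  simp only [e, Finset.sum_add_distrib, Finset.sum_sub_distrib]
  have hr : ∑ k : Fin n, ((X : K[X]) ^ ((k.rev : ℕ) + 2)) ^ 2
      = ∑ k : Fin n, ((X : K[X]) ^ ((k : ℕ) + 2)) ^ 2 :=
    Equiv.sum_comp Fin.revPerm (fun k : Fin n => ((X : K[X]) ^ ((k : ℕ) + 2)) ^ 2)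
  rw [hr]
  have hg := geom_sum_mul (X : K[X]) (n + 2)
  have hmC : (C m : K[X]) = 1 + 2 * C I * (n : K[X]) := by
    rw [hm, C_add, C_mul, C_mul, C_ofNat, C_1, map_natCast]
  have h3 : (C (I * m / 2) : K[X]) = C I * C (m / 2) := by rw [← C_mul]; congr 1; ring
  have h4 : (C m : K[X]) = 2 * C (m / 2) := by
    rw [← C_ofNat, ← C_mul]; congr 1; field_simp
  simp only [Finset.sum_const, Finset.card_univ, Fintype.card_fin, nsmul_eq_mul]
  rw [h3, C_sub, C_1]
  linear_combination (C (m/2))^2 * hIC - X^(n+2) * hg - X^(n+3) * hmC + X^(n+2) * h4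

open Polynomial in
theorem base2_coeff {K : Type*} [Field K] (n : ℕ) (I m : K) (c : Fin (n + 2) → K) (e : ℕ) :
    (∑ i, c i • base2 n I m i).coeff e
      = c 0 * ((if e = n + 2 then 1 else 0) - if e = 0 then m / 2 else 0)
       + (c 1 * (if e = 0 then I * m / 2 else 0)
       + ∑ k : Fin n, c k.succ.succ * ((if e = k + 2 then 1 else 0)
            + I * if e = k.rev + 2 then 1 else 0)) := by
  unfold base2
  rw [Fin.sum_univ_succ, Fin.sum_univ_succ]
  simp only [Fin.cons_zero, Fin.cons_succ]
  simp only [coeff_add, coeff_sub, coeff_smul, smul_eq_mul, finsetSum_coeff, coeff_C_mul, coeff_X_pow,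
    coeff_C, Fin.succ_zero_eq_one]

open Polynomial in
theorem base2_coeff1 {K : Type*} [Field K] (n : ℕ) (I m : K) (i : Fin (n + 2)) :
    (base2 n I m i).coeff 1 = 0 := by
  unfold base2
  refine Fin.cases ?_ (fun i => Fin.cases ?_ (fun i => ?_) i) i
  · simp [coeff_X_pow, coeff_C]
  · simp [coeff_C]
  · simp [coeff_X_pow]

open Polynomial in
theorem base2_coeffd {K : Type*} [Field K] (n : ℕ) (I m : K) (i : Fin (n + 2)) :
    (base2 n I m i).coeff (n + 2) = if i = 0 then 1 else 0 := by
  unfold base2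
  refine Fin.cases ?_ (fun i => Fin.cases ?_ (fun i => ?_) i) i
  · simp [coeff_X_pow, coeff_C]
  · simp [coeff_C]
  · have h1 : n ≠ (i : ℕ) := by omega
    have h2 : n ≠ (i.rev : ℕ) := by have := i.rev.2; omega
    simp only [Fin.cons_succ, coeff_add, coeff_X_pow, coeff_C_mul, Fin.succ_ne_zero, if_false]
    simp [h1, -Fin.val_rev, h2]

open Polynomial in
theorem base2_deg {K : Type*} [Field K] (n : ℕ) (I m : K) (i : Fin (n + 2)) :
    (base2 n I m i).natDegree ≤ n + 2 := by
  unfold base2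
  refine Fin.cases ?_ (fun i => Fin.cases ?_ (fun i => ?_) i) i
  · simp only [Fin.cons_zero]; compute_degree
  · simp
  · simp only [Fin.cons_succ]
    refine (natDegree_add_le _ _).trans (max_le ?_ ?_)
    · simp
    · refine (natDegree_C_mul_X_pow_le _ _).trans ?_
      have := i.rev.2; omega

open Polynomial in
theorem base2_indep {K : Type*} [Field K] (n : ℕ) (I m : K) (hI : I ^ 2 = -1) (h2 : (2 : K) ≠ 0)
    (hm : m ≠ 0) (s : K) : ∀ (c : Fin (n + 2) → K) (a b : K),
        (∑ i, c i • base2 n I m i) + a • (C s + ∑ k ∈ Finset.range (n + 2), X ^ k)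
          + b • (X ^ (n + 3) - X ^ (n + 2)) = 0 → (∀ i, c i = 0) ∧ a = 0 ∧ b = 0 := by
  intro c a b hc
  have hI0 : I ≠ 0 := by rintro rfl; norm_num at hI
  have H : ∀ e, _ := fun e => congrArg (fun q : K[X] => q.coeff e) hc
  simp only [coeff_add, base2_coeff] at H
  simp only [coeff_smul, coeff_add, coeff_sub, coeff_X_pow, coeff_C, finsetSum_coeff,
    coeff_zero, smul_eq_mul] at H
  have hb : b = 0 := by
    have := H (n + 3)
    rw [Finset.sum_eq_zero, Finset.sum_eq_zero] at this
    · simpa using this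
    · intro k hk; rw [Finset.mem_range] at hk; rw [if_neg (by omega)]
    · intro k _
      have := k.rev.2
      rw [if_neg (by omega), if_neg (by omega)]; simp
  subst hb
  have ha : a = 0 := by
    have := H 1
    rw [Finset.sum_eq_zero] at this
    · simpa using this
    · intro k _
      rw [if_neg (by omega), if_neg (by omega)]; simp
  subst ha
  simp only [zero_mul, add_zero] at H
  have hc0 : c 0 = 0 := by
    have := H (n + 2)
    rw [Finset.sum_eq_zero] at this
    · simpa using this
    · intro k _
      have := k.rev.2
      rw [if_neg (by omega), if_neg (by omega)]; simp
  have hc1 : c 1 = 0 := by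
    have := H 0
    rw [Finset.sum_eq_zero] at this
    · simpa [hc0, hI0, hm, h2] using this
    · intro k _
      rw [if_neg (by omega), if_neg (by omega)]; simp
  have hk : ∀ k : Fin n, c k.succ.succ + c k.rev.succ.succ * I = 0 := by
    intro k
    have h := H (k + 2)
    have e1 : ∀ j : Fin n, ((k : ℕ) + 2 = j + 2) ↔ j = k := fun j => by
      rw [Fin.ext_iff]; omega
    simp only [e1, Fin.rev_eq_iff] at h
    simpa [hc0, mul_add, Finset.sum_add_distrib] using h
  refine ⟨fun i => ?_, rfl, rfl⟩
  refine Fin.cases hc0 (fun i => Fin.cases hc1 (fun i => ?_) i) i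
  have h3 := hk i
  have h4 := hk i.rev
  rw [Fin.rev_rev] at h4
  have : 2 * c i.succ.succ = 0 := by linear_combination h3 - I * h4 + c i.succ.succ * hI
  simpa [h2] using this

/-- **Theorem 2.1.** For `d ≥ 2` and a prime `p ≡ 1 (mod 4)` with `p > (d+1)!`,
there exist polynomials `f 1, …, f d, g, h ∈ 𝔽_p[t]` with:
(identity) `f 1 ^ 2 + ⋯ + f d ^ 2 = g * h`;
(degree) `deg (f i) = d`, `deg g = d - 1`, `deg h = d + 1`;
(independence) `f 1, …, f d, g, h` are linearly independent over `𝔽_p`;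
(vanish) the coefficient of `t¹` in each `f i` and in `h` is zero. -/
theorem statement2 (d p : ℕ) (hd : 2 ≤ d) (hp : p.Prime) (hmod : p % 4 = 1)
    (hbig : (d + 1).factorial < p) :
    ∃ (f : Fin d → Polynomial (ZMod p)) (g h : Polynomial (ZMod p)),
      (∑ i, (f i) ^ 2) = g * h ∧
      (∀ i, (f i).natDegree = d) ∧ g.natDegree = d - 1 ∧ h.natDegree = d + 1 ∧
      (∀ (c : Fin d → ZMod p) (a b : ZMod p),
        (∑ i, c i • f i) + a • g + b • h = 0 → (∀ i, c i = 0) ∧ a = 0 ∧ b = 0) ∧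
      (∀ i, (f i).coeff 1 = 0) ∧ h.coeff 1 = 0 := by
  haveI : Fact p.Prime := ⟨hp⟩
  obtain ⟨n, rfl⟩ : ∃ n, d = n + 2 := ⟨d - 2, by omega⟩
  have hself := Nat.self_le_factorial (n + 2 + 1)
  have h6 : 6 < p := by
    have : Nat.factorial 3 ≤ (n + 2 + 1).factorial := Nat.factorial_le (by omega)
    have e : Nat.factorial 3 = 6 := rfl
    omega
  have hne : ∀ k : ℕ, 0 < k → k < p → (k : ZMod p) ≠ 0 := by
    intro k h0 hk h
    rw [ZMod.natCast_eq_zero_iff] at h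
    exact absurd (Nat.le_of_dvd h0 h) (by omega)
  have h2 : (2 : ZMod p) ≠ 0 := by exact_mod_cast hne 2 (by omega) (by omega)
  have h3 : (3 : ZMod p) ≠ 0 := by exact_mod_cast hne 3 (by omega) (by omega)
  have h5 : (5 : ZMod p) ≠ 0 := by exact_mod_cast hne 5 (by omega) (by omega)
  obtain ⟨I, m, hI, hmd, hm⟩ : ∃ I m : ZMod p, I ^ 2 = -1 ∧ m = 1 + 2 * I * n ∧ m ≠ 0 := by
    obtain ⟨I, hI⟩ := (ZMod.exists_sq_eq_neg_one_iff (p := p)).2 (by omega)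
    by_cases h : 1 + 2 * I * (n : ZMod p) = 0
    · refine ⟨-I, _, by rw [hI]; ring, rfl, fun h' => h2 ?_⟩
      linear_combination h + h'
    · exact ⟨I, _, by rw [hI]; ring, rfl, h⟩
  obtain ⟨u, hu, hN, hN2⟩ : ∃ u : Fin (n + 2) → ZMod p, (∀ i, u i ≠ 0) ∧ ∑ j, u j ^ 2 ≠ 0 ∧
      ∑ j, u j ^ 2 ≠ 2 * u 0 ^ 2 := by
    rcases Nat.eq_zero_or_pos n with rfl | hn
    · refine ⟨![2, 1], ?_, ?_, ?_⟩
      · intro i; fin_cases i <;> simp [h2]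
      · simp; norm_num; exact h5
      · simp; norm_num; intro h; exact h3 (by linear_combination -h)
    · refine ⟨fun _ => 1, by simp, ?_, ?_⟩
      · simpa using hne (n + 2) (by omega) (by omega)
      · have := hne n hn (by omega)
        simpa using this
  have hcoeff : ∀ i e, (refl2 u (base2 n I m) i).coeff e = (base2 n I m i).coeff e
      - (2 * u i / ∑ j, u j ^ 2) * ∑ j, u j * (base2 n I m j).coeff e := by
    intro i e
    simp [refl2, Polynomial.finsetSum_coeff]
  have hs1 : ((∑ k ∈ Finset.range (n + 1), Polynomial.X ^ k : Polynomial (ZMod p))).natDegree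
      ≤ n := by
    refine Polynomial.natDegree_sum_le_of_forall_le _ _ fun k hk => ?_
    rw [Finset.mem_range] at hk
    simp; omega
  refine ⟨refl2 u (base2 n I m),
    Polynomial.C (m - 1) + ∑ k ∈ Finset.range (n + 2), Polynomial.X ^ k,
    Polynomial.X ^ (n + 3) - Polynomial.X ^ (n + 2), ?_, ?_, ?_, ?_, ?_, ?_, ?_⟩
  · rw [refl2_sq _ _ hN, base2_sq n I m hI h2 hmd]
  · intro i
    refine Polynomial.natDegree_eq_of_le_of_coeff_ne_zero ?_ ?_
    · refine Polynomial.natDegree_le_iff_coeff_eq_zero.2 fun e he => ?_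
      rw [hcoeff]
      have : ∀ j, (base2 n I m j).coeff e = 0 := fun j =>
        Polynomial.coeff_eq_zero_of_natDegree_lt ((base2_deg n I m j).trans_lt he)
      simp [this]
    · rw [hcoeff]
      simp only [base2_coeffd]
      simp only [mul_ite, mul_one, mul_zero, Finset.sum_ite_eq', Finset.mem_univ, if_true]
      by_cases hi : i = 0
      · subst hi
        rw [if_pos rfl]
        intro h
        apply hN2
        field_simp at h
        linear_combination h
      · rw [if_neg hi]
        have := hu i
        have := hu 0
        simp [*]
  · rw [Finset.sum_range_succ]
    refine Polynomial.natDegree_eq_of_le_of_coeff_ne_zero ?_ ?_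
    · refine (Polynomial.natDegree_add_le _ _).trans (max_le ?_ ?_)
      · rw [Polynomial.natDegree_C]; omega
      refine (Polynomial.natDegree_add_le _ _).trans (max_le (by omega) ?_)
      simp
    · simp only [Polynomial.coeff_add]
      rw [Polynomial.coeff_eq_zero_of_natDegree_lt (lt_of_le_of_lt hs1 (by omega))]
      rw [Polynomial.coeff_C, if_neg (by omega)]
      simp
  · compute_degree!
  · exact refl2_indep u _ _ _ hN (base2_indep n I m hI h2 hm _)
  · intro i
    rw [hcoeff]
    simp [base2_coeff1]
  · simp [Polynomial.coeff_X_pow]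
end

section
/- Let p be a prime, let d ≥ 2, let λ_1, …, λ_d be distinct elements of 𝔽_p, set g_j := ∏_{k ≠ j} (t − λ_k) for j = 1, …, d, and for an arbitrary d×d matrix A = (a_{i,j}) over 𝔽_p define f_i := Σ_{j=1}^d (a_{i,j}/g_j(λ_j))·g_j + ∏_{j=1}^d (t − λ_j) for i = 1, …, d. Then there exists j ∈ {1, …, d} such that g_j does not lie in the 𝔽_p-linear span of f_1, …, f_d. -/
/-- **Claim 2.2.** Let `p` be a prime, `d ≥ 2`, `λ_1, …, λ_d` distinct in `𝔽_p`,
`g j = ∏_{k ≠ j} (t - λ_k)`, and for a `d × d` matrix `A = (a i j)` over `𝔽_p` let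
`f i = ∑_j (a i j / g j (λ_j)) • g j + ∏_j (t - λ_j)`. Then some `g j` does not lie
in the `𝔽_p`-linear span of `f 1, …, f d`. -/
theorem statement3 (p d : ℕ) [Fact p.Prime] (hd : 2 ≤ d)
    (lam : Fin d → ZMod p) (hlam : Function.Injective lam)
    (a : Fin d → Fin d → ZMod p)
    (g f : Fin d → Polynomial (ZMod p))
    (hg : ∀ j, g j = ∏ k ∈ Finset.univ.erase j, (Polynomial.X - Polynomial.C (lam k)))
    (hf : ∀ i, f i = (∑ j, Polynomial.C (a i j / (g j).eval (lam j)) * g j)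
        + ∏ j, (Polynomial.X - Polynomial.C (lam j))) :
    ∃ j, g j ∉ Submodule.span (ZMod p) (Set.range f) := by
  by_contra! hcon
  have hev : ∀ i j, i ≠ j → (g j).eval (lam i) = 0 := by
    intro i j hij
    rw [hg, Polynomial.eval_prod]
    exact Finset.prod_eq_zero (i := i) (by simp [hij]) (by simp)
  have hne : ∀ j, (g j).eval (lam j) ≠ 0 := by
    intro j
    rw [hg, Polynomial.eval_prod, Finset.prod_ne_zero_iff]
    intro k hk
    have hk' : k ≠ j := by simpa using hk
    simp only [Polynomial.eval_sub, Polynomial.eval_X, Polynomial.eval_C]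
    exact sub_ne_zero.mpr fun h => hk' (hlam h).symm
  have hli : LinearIndependent (ZMod p) g := by
    rw [Fintype.linearIndependent_iff]
    intro c hc i
    have h := congrArg (Polynomial.eval (lam i)) hc
    rw [Polynomial.eval_finset_sum, Finset.sum_eq_single i] at h
    · simpa [hne i] using h
    · intro b _ hb
      simp [hev i b hb.symm]
    · simp
  have hle : Submodule.span (ZMod p) (Set.range g) ≤ Submodule.span (ZMod p) (Set.range f) := by
    rw [Submodule.span_le]
    rintro _ ⟨j, rfl⟩
    exact hcon j
  have : FiniteDimensional (ZMod p) (Submodule.span (ZMod p) (Set.range f)) :=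
    FiniteDimensional.span_of_finite _ (Set.finite_range f)
  have heq : Submodule.span (ZMod p) (Set.range g) = Submodule.span (ZMod p) (Set.range f) := by
    apply Submodule.eq_of_le_of_finrank_le hle
    rw [finrank_span_eq_card hli]
    exact finrank_range_le_card f
  have i0 : Fin d := ⟨0, by omega⟩
  have hdeg : Submodule.span (ZMod p) (Set.range g) ≤ Polynomial.degreeLT (ZMod p) d := by
    rw [Submodule.span_le]
    rintro _ ⟨j, rfl⟩
    rw [SetLike.mem_coe, Polynomial.mem_degreeLT, hg, Polynomial.degree_prod]
    simp only [Polynomial.degree_X_sub_C, Finset.sum_const, Finset.card_erase_of_mem (Finset.mem_univ j), Finset.card_univ, Fintype.card_fin, nsmul_eq_mul, mul_one]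
    exact_mod_cast (by omega : d - 1 < d)
  have h1 : f i0 ∈ Submodule.span (ZMod p) (Set.range g) := by
    rw [heq]
    exact Submodule.subset_span ⟨i0, rfl⟩
  rw [hf, Submodule.add_mem_iff_right] at h1
  · have h2 := hdeg h1
    rw [Polynomial.mem_degreeLT, Polynomial.degree_prod] at h2
    simp at h2
  · refine Submodule.sum_mem _ fun j _ => ?_
    rw [← Polynomial.smul_eq_C_mul]
    exact Submodule.smul_mem _ _ (Submodule.subset_span ⟨j, rfl⟩)
end

section
/- Let d ≥ 2 and let p be a prime with p ≡ 1 (mod 4) and p > (d+1)!. Let α ∈ 𝔽_p satisfy α² + 1 = 0, set λ_i := i − 1 ∈ 𝔽_p for i = 1, …, d, and set g_j := ∏_{k ≠ j} (t − λ_k). Let A = (a_{i,j}) be the d×d matrix over 𝔽_p with a_{i,i} = 1, a_{j+1,j} = α for j = 1, …, d−1, a_{1,d} = εα for a choice of sign ε ∈ {+1, −1} making A invertible, and all other entries 0. Define f_i := Σ_{j=1}^d (a_{i,j}/g_j(λ_j))·g_j + ∏_{j=1}^d (t − λ_j). Then there exists j ∈ {2, …, d} such that g_j does not lie in the 𝔽_p-linear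 span of f_1, …, f_d. -/
/-- **Claim 2.5.** Let `d ≥ 2` and `p` be a prime with `p ≡ 1 (mod 4)`, `p > (d+1)!`.
Let `α ∈ 𝔽_p` satisfy `α² + 1 = 0`, `λ_i = i - 1` (zero-based: `lam i = i`),
`g j = ∏_{k ≠ j} (t - λ_k)`, and let `A` be the matrix with `1`'s on the diagonal,
`α`'s just below the diagonal, `ε·α` in the top-right corner for a sign `ε ∈ {1, -1}`
making `A` invertible, and zeros elsewhere. With
`f i = ∑_j (A i j / g j (λ_j)) • g j + ∏_j (t - λ_j)`, there exists `j ≠ 1`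
(zero-based: `j ≠ 0`) such that `g j` does not lie in the span of `f 1, …, f d`. -/
theorem statement6 (d p : ℕ) [Fact p.Prime] (hd : 2 ≤ d)
    (hmod : p % 4 = 1) (hbig : (d + 1).factorial < p)
    (α : ZMod p) (hα : α ^ 2 + 1 = 0)
    (lam : Fin d → ZMod p) (hlam : ∀ i, lam i = ((i : ℕ) : ZMod p))
    (ε : ZMod p) (hε : ε = 1 ∨ ε = -1)
    (A : Matrix (Fin d) (Fin d) (ZMod p))
    (hA : ∀ i j, A i j = if i = j then 1 else if (i : ℕ) = (j : ℕ) + 1 then α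
        else if (i : ℕ) = 0 ∧ (j : ℕ) = d - 1 then ε * α else 0)
    (hdet : IsUnit A.det)
    (g f : Fin d → Polynomial (ZMod p))
    (hg : ∀ j, g j = ∏ k ∈ Finset.univ.erase j, (Polynomial.X - Polynomial.C (lam k)))
    (hf : ∀ i, f i = (∑ j, Polynomial.C (A i j / (g j).eval (lam j)) * g j)
        + ∏ j, (Polynomial.X - Polynomial.C (lam j))) :
    ∃ j : Fin d, (j : ℕ) ≠ 0 ∧ g j ∉ Submodule.span (ZMod p) (Set.range f) := by
  classical
  have hdp : d < p := by
    have := Nat.self_le_factorial (d + 1)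
    omega
  have hinj : Function.Injective lam := by
    intro a b hab
    rw [hlam, hlam] at hab
    have h := (ZMod.natCast_eq_natCast_iff' _ _ _).1 hab
    rw [Nat.mod_eq_of_lt (a.2.trans hdp), Nat.mod_eq_of_lt (b.2.trans hdp)] at h
    exact Fin.ext h
  have hgne : ∀ j, (g j).eval (lam j) ≠ 0 := by
    intro j
    rw [hg, Polynomial.eval_prod, Finset.prod_ne_zero_iff]
    intro k hk
    have hkj := (Finset.mem_erase.1 hk).1
    simp only [Polynomial.eval_sub, Polynomial.eval_X, Polynomial.eval_C]
    exact sub_ne_zero.2 fun h => hkj (hinj h).symm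
  have hgz : ∀ j k, k ≠ j → (g j).eval (lam k) = 0 := by
    intro j k hkj
    rw [hg, Polynomial.eval_prod]
    exact Finset.prod_eq_zero (Finset.mem_erase.2 ⟨hkj, Finset.mem_univ k⟩) (by simp)
  have hgc : ∀ j, (g j).coeff d = 0 := by
    intro j
    apply Polynomial.coeff_eq_zero_of_natDegree_lt
    rw [hg, Polynomial.natDegree_prod_of_monic _ _ (fun k _ => Polynomial.monic_X_sub_C _)]
    simp
    omega
  have hPc : (∏ j, (Polynomial.X - Polynomial.C (lam j))).coeff d = 1 := by
    have hm : (∏ j, (Polynomial.X - Polynomial.C (lam j))).Monic :=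
      Polynomial.monic_prod_of_monic _ _ (fun k _ => Polynomial.monic_X_sub_C _)
    have hn : (∏ j, (Polynomial.X - Polynomial.C (lam j))).natDegree = d := by
      rw [Polynomial.natDegree_prod_of_monic _ _ (fun k _ => Polynomial.monic_X_sub_C _)]
      simp
    have := hm.coeff_natDegree
    rwa [hn] at this
  have hfe : ∀ i k, (f i).eval (lam k) = A i k := by
    intro i k
    rw [hf, Polynomial.eval_add, Polynomial.eval_finset_sum, Polynomial.eval_prod,
      Finset.prod_eq_zero (Finset.mem_univ k) (by simp), add_zero,
      Finset.sum_eq_single k]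
    · rw [Polynomial.eval_mul, Polynomial.eval_C, div_mul_cancel₀ _ (hgne k)]
    · intro j _ hjk
      rw [Polynomial.eval_mul, hgz j k hjk.symm, mul_zero]
    · simp
  have hfc : ∀ i, (f i).coeff d = 1 := by
    intro i
    rw [hf, Polynomial.coeff_add, hPc, Polynomial.finset_sum_coeff]
    simp [hgc]
  by_contra hcon
  push Not at hcon
  let v : Fin d → ZMod p := A⁻¹.mulVec (fun _ => 1)
  have hv : ∀ i, ∑ k, A i k * v k = 1 := by
    intro i
    have h : A.mulVec v = fun _ => 1 := by
      simp only [v]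
      rw [Matrix.mulVec_mulVec, Matrix.mul_nonsing_inv _ hdet, Matrix.one_mulVec]
    exact congrFun h i
  let L : Polynomial (ZMod p) →ₗ[ZMod p] ZMod p :=
    (∑ k, v k • Polynomial.leval (lam k)) - Polynomial.lcoeff (ZMod p) d
  have hL : ∀ q, L q = (∑ k, v k * q.eval (lam k)) - q.coeff d := by
    intro q
    simp [L, Polynomial.leval]
  have hker : Submodule.span (ZMod p) (Set.range f) ≤ LinearMap.ker L := by
    rw [Submodule.span_le]
    rintro _ ⟨i, rfl⟩
    rw [SetLike.mem_coe, LinearMap.mem_ker, hL, hfc, sub_eq_zero, ← hv i]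
    exact Finset.sum_congr rfl fun k _ => by rw [hfe, mul_comm]
  have hv0 : ∀ j : Fin d, (j : ℕ) ≠ 0 → v j = 0 := by
    intro j hj
    have h := hker (hcon j hj)
    rw [LinearMap.mem_ker, hL, hgc, sub_zero, Finset.sum_eq_single j] at h
    · exact (mul_eq_zero.1 h).resolve_right (hgne j)
    · intro k _ hk
      rw [hgz j k hk, mul_zero]
    · simp
  have hrow : ∀ i, A i ⟨0, by omega⟩ * v ⟨0, by omega⟩ = 1 := by
    intro i
    rw [← hv i, Finset.sum_eq_single (⟨0, by omega⟩ : Fin d)]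
    · intro k _ hk
      rw [hv0 k (fun h => hk (Fin.ext h)), mul_zero]
    · simp
  have h0 := hrow ⟨0, by omega⟩
  have h1 := hrow ⟨1, by omega⟩
  rw [hA] at h0 h1
  simp at h0 h1
  rw [h0, mul_one] at h1
  rw [h1] at hα
  have h2 : ((2 : ℕ) : ZMod p) = 0 := by
    push_cast
    linear_combination hα
  rw [ZMod.natCast_eq_zero_iff] at h2
  have := Nat.le_of_dvd (by norm_num) h2
  omega
end

section
/- Let d ≥ 2 be an integer and let p be a prime with p ≡ 1 (mod 4) and p > (d+1)!. Then there exists a subset S ⊆ 𝔽_p^d with |S| ≥ p − d − 2 such that no hyperplane in 𝔽_p^d contains d+2 points of S and no sphere in 𝔽_p^d contains d+2 points of S. -/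
open Polynomial in
/-- Points of the curve lying on the zero set of a nonzero polynomial of degree at most `d + 1`. -/
lemma card_aux {F V : Type*} [Field F] [DecidableEq F] [DecidableEq V] (d : ℕ) (φ : F → V)
    (Q : F[X]) (hQ : Q ≠ 0) (hdeg : Q.natDegree ≤ d + 1) (T : Finset V)
    (hT : ∀ x ∈ T, ∃ t, φ t = x ∧ Q.eval t = 0) : T.card ≤ d + 1 := by
  have h1 : T ⊆ Q.roots.toFinset.image φ := by
    intro x hx
    obtain ⟨t, ht, h0⟩ := hT x hx
    refine Finset.mem_image.2 ⟨t, ?_, ht⟩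
    rw [Multiset.mem_toFinset, mem_roots hQ]
    exact h0
  calc T.card ≤ _ := Finset.card_le_card h1
    _ ≤ _ := Finset.card_image_le
    _ ≤ _ := Multiset.toFinset_card_le _
    _ ≤ _ := Q.card_roots'
    _ ≤ _ := hdeg

open Polynomial in
/-- The polynomial `a t^(d+1) + ∑ b_i t^(i+1) + c`. -/
noncomputable def qpoly {F : Type*} [Field F] (d : ℕ) (a : F) (b : Fin d → F) (c : F) : F[X] :=
  C a * X ^ (d + 1) + (∑ i : Fin d, C (b i) * X ^ (i.val + 1)) + C c

open Polynomial in
lemma qpoly_deg {F : Type*} [Field F] (d : ℕ) (a : F) (b : Fin d → F) (c : F) :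
    (qpoly d a b c).natDegree ≤ d + 1 := by
  unfold qpoly
  refine natDegree_add_le_of_degree_le (natDegree_add_le_of_degree_le
    (natDegree_C_mul_X_pow_le _ _) ?_) (by simp)
  refine natDegree_sum_le_of_forall_le _ _ ?_
  intro i _
  exact (natDegree_C_mul_X_pow_le _ _).trans (by omega)

open Polynomial in
lemma qpoly_top {F : Type*} [Field F] (d : ℕ) (a : F) (b : Fin d → F) (c : F) :
    (qpoly d a b c).coeff (d + 1) = a := by
  have h : ∀ i : Fin d, d ≠ i.val := fun i => by omega
  simp [qpoly, coeff_X_pow, coeff_C, h]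

open Polynomial in
lemma qpoly_coeff {F : Type*} [Field F] (d : ℕ) (a : F) (b : Fin d → F) (c : F) (j : Fin d) :
    (qpoly d a b c).coeff (j.val + 1) = b j := by
  have h : j.val ≠ d := by omega
  simp [qpoly, coeff_X_pow, coeff_C, h, Fin.val_inj]

open Polynomial in
lemma qpoly_eval {F : Type*} [Field F] (d : ℕ) (a : F) (b : Fin d → F) (c t : F) :
    (qpoly d a b c).eval t = a * t ^ (d + 1) + (∑ i : Fin d, b i * t ^ (i.val + 1)) + c := by
  simp [qpoly, eval_finset_sum]

/-- The curve. -/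
def curve {F : Type*} [Field F] (d : ℕ) (e : F) (t : F) : Fin d → F :=
  fun i => t ^ (i.val + 1) + e * t ^ ((Fin.rev i).val + 1)

lemma curve_lin {F : Type*} [Field F] (d : ℕ) (e t : F) (l : Fin d → F) :
    ∑ i, l i * curve d e t i = ∑ i, (l i + e * l (Fin.rev i)) * t ^ (i.val + 1) := by
  have h := Equiv.sum_comp Fin.revPerm (fun i : Fin d => e * l (Fin.rev i) * t ^ (i.val + 1))
  simp only [Fin.revPerm_apply, Fin.rev_rev] at h
  simp only [add_mul, Finset.sum_add_distrib, ← h]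
  rw [← Finset.sum_add_distrib]
  refine Finset.sum_congr rfl fun i _ => ?_
  unfold curve
  ring

lemma curve_sq {F : Type*} [Field F] (d : ℕ) (e t : F) (he : e * e = -1) :
    ∑ i, (curve d e t i) ^ 2 = (2 * e * d) * t ^ (d + 1) := by
  have h := Equiv.sum_comp Fin.revPerm (fun i : Fin d => (t ^ (i.val + 1)) ^ 2)
  simp only [Fin.revPerm_apply] at h
  have h2 : ∀ i : Fin d, (curve d e t i) ^ 2 =
      (t ^ (i.val + 1)) ^ 2 - (t ^ ((Fin.rev i).val + 1)) ^ 2 + 2 * e * t ^ (d + 1) := by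
    intro i
    have h3 : t ^ (d + 1) = t ^ (i.val + 1) * t ^ ((Fin.rev i).val + 1) := by
      rw [← pow_add]
      congr 1
      rw [Fin.val_rev]
      omega
    rw [h3]
    unfold curve
    linear_combination (t ^ ((Fin.rev i).val + 1)) ^ 2 * he
  simp only [h2, Finset.sum_add_distrib, Finset.sum_sub_distrib, h]
  simp
  ring

lemma curve_inj {F : Type*} [Field F] (d : ℕ) (hd : 2 ≤ d) (e : F) (he : e * e = -1)
    (h2 : (2 : F) ≠ 0) : Function.Injective (curve d e) := by
  have key : ∀ t, 2 * t = curve d e t ⟨0, by omega⟩ - e * curve d e t (Fin.rev ⟨0, by omega⟩) := by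
    intro t
    simp only [curve, Fin.rev_rev]
    linear_combination t * he
  intro s t hst
  apply mul_left_cancel₀ h2
  rw [key s, key t, hst]

/-- **Finite-field construction for Theorem 1.2.** For `d ≥ 2` and a prime
`p ≡ 1 (mod 4)` with `p > (d+1)!`, there is a subset `S ⊆ 𝔽_p^d` with
`|S| ≥ p - d - 2` such that no hyperplane `{x : λ_1 x_1 + ⋯ + λ_d x_d + λ = 0}`
(with `(λ_1, …, λ_d) ≠ 0`) contains `d + 2` points of `S`, and no sphere
`{x : x_1² + ⋯ + x_d² + μ_1 x_1 + ⋯ + μ_d x_d + μ = 0}` contains `d + 2` points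
of `S`. -/
theorem statement8 (d p : ℕ) (hd : 2 ≤ d) (hp : p.Prime) (hmod : p % 4 = 1)
    (hbig : (d + 1).factorial < p) :
    ∃ S : Finset (Fin d → ZMod p),
      (p : ℤ) - d - 2 ≤ (S.card : ℤ) ∧
      (∀ (lam : Fin d → ZMod p) (c : ZMod p), lam ≠ 0 →
        ∀ T ⊆ S, (∀ x ∈ T, (∑ i, lam i * x i) + c = 0) → T.card ≤ d + 1) ∧
      (∀ (mu : Fin d → ZMod p) (c : ZMod p),
        ∀ T ⊆ S, (∀ x ∈ T, (∑ i, (x i) ^ 2) + (∑ i, mu i * x i) + c = 0) →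
          T.card ≤ d + 1) := by
  haveI : Fact p.Prime := ⟨hp⟩
  classical
  obtain ⟨e, he⟩ := (ZMod.exists_sq_eq_neg_one_iff (p := p)).2 (by omega)
  have he : e * e = -1 := he.symm
  have hdp : d < p := by
    have := Nat.self_le_factorial (d + 1)
    omega
  have cast_ne : ∀ n : ℕ, 0 < n → n < p → (n : ZMod p) ≠ 0 := by
    intro n h0 h1 h
    rw [ZMod.natCast_eq_zero_iff] at h
    exact absurd (Nat.le_of_dvd h0 h) (by omega)
  have h2 : (2 : ZMod p) ≠ 0 := by
    exact_mod_cast cast_ne 2 (by omega) (by omega)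
  have hd0 := cast_ne d (by omega) hdp
  have he0 : e ≠ 0 := by
    rintro rfl
    simp at he
  refine ⟨Finset.univ.image (curve d e), ?_, ?_, ?_⟩
  · rw [Finset.card_image_of_injective _ (curve_inj d hd e he h2), Finset.card_univ, ZMod.card]
    omega
  · intro lam c hlam T hT hz
    refine card_aux d (curve d e) (qpoly d 0 (fun i => lam i + e * lam (Fin.rev i)) c) ?_
      (qpoly_deg _ _ _ _) T ?_
    · intro h0
      apply hlam
      have hc : ∀ i, lam i + e * lam (Fin.rev i) = 0 := by
        intro i
        rw [← qpoly_coeff d 0 (fun i => lam i + e * lam (Fin.rev i)) c i, h0]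
        simp
      funext i
      have h3 := hc i
      have h4 := hc (Fin.rev i)
      rw [Fin.rev_rev] at h4
      have : 2 * lam i = 0 := by linear_combination h3 - e * h4 + lam i * he
      simpa [h2] using this
    · intro x hx
      obtain ⟨t, -, rfl⟩ := Finset.mem_image.1 (hT hx)
      refine ⟨t, rfl, ?_⟩
      have := hz _ hx
      rw [curve_lin] at this
      rw [qpoly_eval]
      linear_combination this
  · intro mu c T hT hz
    refine card_aux d (curve d e)
      (qpoly d (2 * e * d) (fun i => mu i + e * mu (Fin.rev i)) c) ?_ (qpoly_deg _ _ _ _) T ?_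
    · intro h0
      have := qpoly_top d (2 * e * d) (fun i => mu i + e * mu (Fin.rev i)) c
      rw [h0] at this
      exact mul_ne_zero (mul_ne_zero h2 he0) hd0 (by simpa using this.symm)
    · intro x hx
      obtain ⟨t, -, rfl⟩ := Finset.mem_image.1 (hT hx)
      refine ⟨t, rfl, ?_⟩
      have := hz _ hx
      rw [curve_lin, curve_sq d e t he] at this
      rw [qpoly_eval]
      linear_combination this
end

section
/- Let d ≥ 2 be an integer and let p be a prime with p ≡ 1 (mod 4) and p > (d+1)!. Then there exists a subset S ⊆ 𝔽_p^d with |S| ≥ ⌊(p−1)/(d+1)⌋ − d − 2 such that no hyperplane in 𝔽_p^d contains d+1 points of S and no sphere in 𝔽_p^d contains d+2 points of S. -/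
open Polynomial in
/-- The points of the curve `g` indexed by roots of a nonzero polynomial of degree at most `n`. -/
theorem card_le_of_curve {F V : Type*} [Field F] [Fintype F] [DecidableEq F] [DecidableEq V]
    (g : F → V) (P : F[X]) (hP : P ≠ 0) (n : ℕ) (hn : P.natDegree ≤ n) (T : Finset V)
    (hT : ∀ x ∈ T, ∃ t, g t = x ∧ P.eval t = 0) : T.card ≤ n := by
  have h1 : T ⊆ P.roots.toFinset.image g := by
    intro x hx
    obtain ⟨t, ht, h0⟩ := hT x hx
    rw [Finset.mem_image]
    exact ⟨t, by simp [hP, h0], ht⟩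
  calc T.card ≤ (P.roots.toFinset.image g).card := Finset.card_le_card h1
    _ ≤ P.roots.toFinset.card := Finset.card_image_le
    _ ≤ P.roots.card := Multiset.toFinset_card_le _
    _ ≤ P.natDegree := P.card_roots'
    _ ≤ n := hn

open Polynomial in
/-- The polynomial obtained by restricting an affine form to the curve. -/
noncomputable def curvePoly {F : Type*} [Field F] (d : ℕ) (I : F) (lam : Fin d → F) (c : F) : F[X] :=
  (∑ i : Fin d, C (lam i) * (X ^ (i.val + 1) + C I * X ^ (d - i.val))) + C c

open Polynomial in
theorem curvePoly_natDegree {F : Type*} [Field F] (d : ℕ) (I : F) (lam : Fin d → F) (c : F) :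
    (curvePoly d I lam c).natDegree ≤ d := by
  unfold curvePoly
  refine natDegree_add_le_of_degree_le ?_ (by simp)
  refine natDegree_sum_le_of_forall_le _ _ ?_
  intro i _
  refine (natDegree_C_mul_le _ _).trans ?_
  refine natDegree_add_le_of_degree_le ?_ ?_
  · rw [natDegree_X_pow]; omega
  · refine (natDegree_C_mul_le _ _).trans ?_
    rw [natDegree_X_pow]; omega

open Polynomial in
theorem curvePoly_coeff {F : Type*} [Field F] (d : ℕ) (I : F) (lam : Fin d → F) (c : F)
    (j : Fin d) : (curvePoly d I lam c).coeff (j.val + 1) = lam j + I * lam j.rev := by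
  unfold curvePoly
  simp only [coeff_add, finset_sum_coeff, coeff_C_mul, coeff_X_pow, coeff_C, mul_add,
    Finset.sum_add_distrib]
  have h1 : ∀ i : Fin d, (j.val + 1 = i.val + 1) ↔ i = j := by
    intro i; rw [Fin.ext_iff]; omega
  have h2 : ∀ i : Fin d, (j.val + 1 = d - i.val) ↔ i = j.rev := by
    intro i; rw [Fin.ext_iff, Fin.val_rev]; omega
  simp only [h1, h2]
  simp
  ring

theorem statement9 (d p : ℕ) (hd : 2 ≤ d) (hp : p.Prime) (hmod : p % 4 = 1)
    (hbig : (d + 1).factorial < p) :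
    ∃ S : Finset (Fin d → ZMod p),
      (((p - 1) / (d + 1) : ℕ) : ℤ) - d - 2 ≤ (S.card : ℤ) ∧
      (∀ (lam : Fin d → ZMod p) (c : ZMod p), lam ≠ 0 →
        ∀ T ⊆ S, (∀ x ∈ T, (∑ i, lam i * x i) + c = 0) → T.card ≤ d) ∧
      (∀ (mu : Fin d → ZMod p) (c : ZMod p),
        ∀ T ⊆ S, (∀ x ∈ T, (∑ i, (x i) ^ 2) + (∑ i, mu i * x i) + c = 0) →
          T.card ≤ d + 1) := by
  haveI : Fact p.Prime := ⟨hp⟩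
  have hdp : d < p := by
    have := Nat.self_le_factorial (d + 1)
    omega
  have hd0 : (d : ZMod p) ≠ 0 := by
    intro h
    rw [ZMod.natCast_eq_zero_iff] at h
    exact absurd (Nat.le_of_dvd (by omega) h) (by omega)
  have h20 : (2 : ZMod p) ≠ 0 := by
    intro h
    have h' : ((2 : ℕ) : ZMod p) = 0 := by exact_mod_cast h
    rw [ZMod.natCast_eq_zero_iff] at h'
    exact absurd (Nat.le_of_dvd (by omega) h') (by omega)
  obtain ⟨I, hI⟩ : ∃ I : ZMod p, I * I = -1 := by
    have : IsSquare (-1 : ZMod p) := ZMod.exists_sq_eq_neg_one_iff.2 (by omega)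
    obtain ⟨I, hI⟩ := this
    exact ⟨I, hI.symm⟩
  have hI0 : I ≠ 0 := by
    rintro rfl
    simp at hI
  let g : ZMod p → (Fin d → ZMod p) := fun t i => t ^ (i.val + 1) + I * t ^ (d - i.val)
  have hg : Function.Injective g := by
    intro s t hst
    have h1 := congrFun hst ⟨0, by omega⟩
    have h2 := congrFun hst ⟨d - 1, by omega⟩
    have e1 : d - 1 + 1 = d := by omega
    have e2 : d - (d - 1) = 1 := by omega
    simp only [g, e1, e2, zero_add, pow_one, Nat.sub_zero] at h1 h2
    have : 2 * s = 2 * t := by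
      linear_combination h1 - I * h2 + (s - t) * hI
    exact mul_left_cancel₀ h20 this
  have heval : ∀ (lam : Fin d → ZMod p) (c t : ZMod p),
      (curvePoly d I lam c).eval t = (∑ i, lam i * g t i) + c := by
    intro lam c t
    simp [curvePoly, g, Polynomial.eval_finset_sum]
  have hsq : ∀ t : ZMod p, ∑ i, (g t i) ^ 2 = 2 * I * d * t ^ (d + 1) := by
    intro t
    have h1 : ∀ i : Fin d, (g t i) ^ 2 =
        (t ^ (i.val + 1)) ^ 2 - (t ^ (i.rev.val + 1)) ^ 2 + 2 * I * t ^ (d + 1) := by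
      intro i
      have e1 : i.rev.val + 1 = d - i.val := by rw [Fin.val_rev]; omega
      have e2 : t ^ (d + 1) = t ^ (i.val + 1) * t ^ (d - i.val) := by
        rw [← pow_add]; congr 1; omega
      rw [e1, e2]
      simp only [g]
      linear_combination (t ^ (d - i.val)) ^ 2 * hI
    have h2 : ∑ i : Fin d, (t ^ (i.rev.val + 1)) ^ 2 = ∑ i : Fin d, (t ^ (i.val + 1)) ^ 2 :=
      Equiv.sum_comp Fin.revPerm (fun i : Fin d => (t ^ (i.val + 1)) ^ 2)
    simp only [h1]
    rw [Finset.sum_add_distrib, Finset.sum_sub_distrib, h2]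
    simp
    ring
  refine ⟨Finset.univ.image g, ?_, ?_, ?_⟩
  · rw [Finset.card_image_of_injective _ hg, Finset.card_univ, ZMod.card]
    have : (p - 1) / (d + 1) ≤ p := (Nat.div_le_self _ _).trans (Nat.sub_le _ _)
    omega
  · intro lam c hlam T hTS hT
    refine card_le_of_curve g (curvePoly d I lam c) ?_ d (curvePoly_natDegree _ _ _ _) T ?_
    · intro h0
      apply hlam
      funext j
      have h1 := curvePoly_coeff d I lam c j
      have h2 := curvePoly_coeff d I lam c j.rev
      rw [h0, Polynomial.coeff_zero] at h1 h2
      rw [Fin.rev_rev] at h2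
      have : 2 * lam j = 0 := by
        linear_combination -h1 + I * h2 + lam j * hI
      simpa [h20] using this
    · intro x hx
      obtain ⟨t, -, rfl⟩ := Finset.mem_image.1 (hTS hx)
      exact ⟨t, rfl, by rw [heval]; exact hT _ hx⟩
  · intro mu c T hTS hT
    have hdeg := curvePoly_natDegree d I mu c
    refine card_le_of_curve g
      (Polynomial.C (2 * I * d) * Polynomial.X ^ (d + 1) + curvePoly d I mu c) ?_ (d + 1) ?_ T ?_
    · intro h0
      have h1 := congrArg (fun P => Polynomial.coeff P (d + 1)) h0
      simp only [Polynomial.coeff_add, Polynomial.coeff_C_mul, Polynomial.coeff_X_pow,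
        Polynomial.coeff_zero,
        Polynomial.coeff_eq_zero_of_natDegree_lt (Nat.lt_succ_of_le hdeg)] at h1
      simp [h20, hI0, hd0] at h1
    · refine Polynomial.natDegree_add_le_of_degree_le ?_ (by omega)
      exact Polynomial.natDegree_C_mul_X_pow_le _ _
    · intro x hx
      obtain ⟨t, -, rfl⟩ := Finset.mem_image.1 (hTS hx)
      refine ⟨t, rfl, ?_⟩
      have := hT _ hx
      rw [hsq] at this
      rw [Polynomial.eval_add, heval, ← this]
      simp
      ring
end

section
/- Let p be a prime, let d ≥ 2, and let f_1, …, f_d, g, h ∈ 𝔽_p[t] be polynomials with f_1² + ⋯ + f_d² = g·h, deg f_i = d for all i, deg g = d−1, deg h = d+1, and f_1, …, f_d, g, h linearly independent over 𝔽_p. Then for every choice of μ_1, …, μ_d, μ ∈ 𝔽_p, the number of t ∈ 𝔽_p with h(t) ≠ 0 and (f_1(t)/h(t))² + ⋯ + (f_d(t)/h(t))² + μ_1·f_1(t)/h(t) + ⋯ + μ_d·f_d(t)/h(t) + μ = 0 is at most d+1. -/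
/-- **Sphere intersections of the rational curve.** Let `p` be prime, `d ≥ 2`,
`f 1, …, f d, g, h ∈ 𝔽_p[t]` with `f 1² + ⋯ + f d² = g * h`, `deg (f i) = d`,
`deg g = d - 1`, `deg h = d + 1`, and `f 1, …, f d, g, h` linearly independent.
Then for every sphere `{x : x_1² + ⋯ + x_d² + μ_1 x_1 + ⋯ + μ_d x_d + μ = 0}`, the
number of parameters `t` with `h(t) ≠ 0` at which the curve `γ(t) = (f_i(t)/h(t))_i`
meets the sphere is at most `d + 1`. -/
theorem statement12 (p d : ℕ) [Fact p.Prime] (hd : 2 ≤ d)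
    (f : Fin d → Polynomial (ZMod p)) (g h : Polynomial (ZMod p))
    (hident : (∑ i, (f i) ^ 2) = g * h)
    (hdegf : ∀ i, (f i).natDegree = d) (hdegg : g.natDegree = d - 1)
    (hdegh : h.natDegree = d + 1)
    (hind : ∀ (c : Fin d → ZMod p) (a b : ZMod p),
      (∑ i, c i • f i) + a • g + b • h = 0 → (∀ i, c i = 0) ∧ a = 0 ∧ b = 0)
    (mu : Fin d → ZMod p) (c : ZMod p) :
    Set.ncard {t : ZMod p | h.eval t ≠ 0 ∧
        (∑ i, ((f i).eval t / h.eval t) ^ 2)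
          + (∑ i, mu i * ((f i).eval t / h.eval t)) + c = 0} ≤ d + 1 := by
  classical
  set Q : Polynomial (ZMod p) := (∑ i, mu i • f i) + (1 : ZMod p) • g + c • h with hQ
  have hQ0 : Q ≠ 0 := by
    intro h0
    exact one_ne_zero (hind mu 1 c h0).2.1
  have hdeg : Q.natDegree ≤ d + 1 := by
    refine Polynomial.natDegree_add_le_of_degree_le
      (Polynomial.natDegree_add_le_of_degree_le ?_ ?_) ?_
    · refine Polynomial.natDegree_sum_le_of_forall_le _ _ fun i _ => ?_
      refine (Polynomial.natDegree_smul_le _ _).trans ?_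
      rw [hdegf i]
      omega
    · refine (Polynomial.natDegree_smul_le _ _).trans ?_
      omega
    · refine (Polynomial.natDegree_smul_le _ _).trans ?_
      omega
  have hsub : {t : ZMod p | h.eval t ≠ 0 ∧
        (∑ i, ((f i).eval t / h.eval t) ^ 2)
          + (∑ i, mu i * ((f i).eval t / h.eval t)) + c = 0} ⊆
        (Q.roots.toFinset : Set (ZMod p)) := by
    rintro t ⟨ht, he⟩
    have h1 : (∑ i, ((f i).eval t) ^ 2) = g.eval t * h.eval t := by
      have := congrArg (Polynomial.eval t) hident
      simpa [Polynomial.eval_finset_sum] using this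
    have h2 : (∑ i, ((f i).eval t / h.eval t) ^ 2) = g.eval t / h.eval t := by
      simp only [div_pow]
      rw [← Finset.sum_div, h1]
      field_simp
    have h3 : (∑ i, mu i * ((f i).eval t / h.eval t))
        = (∑ i, mu i * (f i).eval t) / h.eval t := by
      rw [Finset.sum_div]
      exact Finset.sum_congr rfl fun i _ => by ring
    rw [h2, h3] at he
    field_simp at he
    have h4 : Q.eval t = 0 := by
      simp only [hQ, Polynomial.eval_add, Polynomial.eval_finset_sum, Polynomial.eval_smul,
        smul_eq_mul, one_mul]
      linear_combination he
    simp [hQ0, h4]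
  calc _ ≤ (Q.roots.toFinset : Set (ZMod p)).ncard :=
        Set.ncard_le_ncard hsub (Finset.finite_toSet _)
    _ = Q.roots.toFinset.card := Set.ncard_coe_finset _
    _ ≤ Q.roots.card := Multiset.toFinset_card_le _
    _ ≤ Q.natDegree := Polynomial.card_roots' Q
    _ ≤ d + 1 := hdeg
end

section
/- Let p be a prime, let d ≥ 2, and let f_1, …, f_d, h ∈ 𝔽_p[t] be polynomials with deg f_i = d for all i, deg h = d+1, and f_1, …, f_d, h linearly independent over 𝔽_p. Define γ(t) := (f_1(t)/h(t), …, f_d(t)/h(t)) ∈ 𝔽_p^d for t with h(t) ≠ 0. Then the image γ({t ∈ 𝔽_p : h(t) ≠ 0}) has cardinality at least p − d − 2. -/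
open Polynomial in
/-- Two functionals killing all `f i` and `h` and separating two low degree polynomials
cannot exist, by a dimension count. -/
theorem no_two_functionals {F : Type*} [Field F] (d : ℕ) (f : Fin d → F[X]) (h : F[X])
    (hdegf : ∀ i, (f i).natDegree = d) (hdegh : h.natDegree = d + 1)
    (hind : ∀ (c : Fin d → F) (b : F),
      (∑ i, c i • f i) + b • h = 0 → (∀ i, c i = 0) ∧ b = 0)
    (A B : F[X] →ₗ[F] F) (hAf : ∀ i, A (f i) = 0) (hAh : A h = 0)
    (hBf : ∀ i, B (f i) = 0) (hBh : B h = 0) (q r : F[X])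
    (hq : q.natDegree ≤ d + 1) (hr : r.natDegree ≤ d + 1)
    (hAq : A q ≠ 0) (hBq : B q = 0) (hBr : B r ≠ 0) : False := by
  have mem : ∀ u : F[X], u.natDegree ≤ d + 1 → u ∈ degreeLT F (d + 2) := by
    intro u hu
    rw [mem_degreeLT]
    refine lt_of_le_of_lt degree_le_natDegree ?_
    exact_mod_cast (by omega : u.natDegree < d + 2)
  let Φ : ((Fin d → F) × F × F × F) →ₗ[F] F[X] :=
    { toFun := fun x => ((∑ i, x.1 i • f i) + x.2.1 • h) + (x.2.2.1 • q + x.2.2.2 • r)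
      map_add' := by
        intro x y
        simp only [Prod.fst_add, Prod.snd_add, Pi.add_apply, add_smul, Finset.sum_add_distrib]
        abel
      map_smul' := by
        intro m x
        simp [smul_smul, Finset.smul_sum, smul_add] }
  have hΦ : ∀ x, Φ x = ((∑ i, x.1 i • f i) + x.2.1 • h) + (x.2.2.1 • q + x.2.2.2 • r) :=
    fun _ => rfl
  have hmem : ∀ x, Φ x ∈ degreeLT F (d + 2) := by
    intro x
    rw [hΦ]
    refine Submodule.add_mem _ (Submodule.add_mem _ (Submodule.sum_mem _ fun i _ =>
      Submodule.smul_mem _ _ (mem _ (by rw [hdegf]; omega))) (Submodule.smul_mem _ _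
        (mem _ hdegh.le))) (Submodule.add_mem _ (Submodule.smul_mem _ _ (mem _ hq))
        (Submodule.smul_mem _ _ (mem _ hr)))
  have hinj : Function.Injective (Φ.codRestrict _ hmem) := by
    rw [← LinearMap.ker_eq_bot, LinearMap.ker_codRestrict, LinearMap.ker_eq_bot']
    rintro ⟨c, b, u, v⟩ hx
    rw [hΦ] at hx
    simp only at hx
    have h1 := congrArg B hx
    simp [hBf, hBh, hBq, hBr] at h1
    have h2 := congrArg A hx
    simp [hAf, hAh, hAq, h1] at h2
    subst h1 h2
    simp only [zero_smul, add_zero] at hx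
    obtain ⟨h3, h4⟩ := hind c b hx
    have : c = 0 := funext h3
    simp [this, h4]
  have hfin : Module.finrank F (degreeLT F (d + 2)) = d + 2 := by
    rw [(degreeLTEquiv F (d + 2)).finrank_eq]; simp
  haveI : Module.Finite F (degreeLT F (d + 2)) :=
    Module.Finite.equiv (degreeLTEquiv F (d + 2)).symm
  have := LinearMap.finrank_le_finrank_of_injective hinj
  rw [hfin] at this
  simp at this

open Polynomial in
theorem no_two_collisions {F : Type*} [Field F] (d : ℕ) (hd : 2 ≤ d)
    (f : Fin d → F[X]) (h : F[X])
    (hdegf : ∀ i, (f i).natDegree = d) (hdegh : h.natDegree = d + 1)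
    (hind : ∀ (c : Fin d → F) (b : F),
      (∑ i, c i • f i) + b • h = 0 → (∀ i, c i = 0) ∧ b = 0)
    (t t' s s' : F) (ht : h.eval t ≠ 0) (ht' : h.eval t' ≠ 0) (hs : h.eval s ≠ 0)
    (hs' : h.eval s' ≠ 0) (htt : t ≠ t') (hss : s ≠ s') (hst : s ≠ t) (hst' : s' ≠ t)
    (e1 : ∀ i, (f i).eval t / h.eval t = (f i).eval t' / h.eval t')
    (e2 : ∀ i, (f i).eval s / h.eval s = (f i).eval s' / h.eval s') : False := by
  let L : F → F[X] →ₗ[F] F := fun t => (h.eval t)⁻¹ • leval t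
  have hL : ∀ t u, L t u = u.eval t / h.eval t := by
    intro t u
    simp [L, leval, div_eq_inv_mul]
  refine no_two_functionals d f h hdegf hdegh hind (L t - L t') (L s - L s')
    ?_ ?_ ?_ ?_ ((X - C t') * (X - C s) * (X - C s')) (X - C s') ?_ ?_ ?_ ?_ ?_
  · intro i; simp [hL, e1]
  · simp [hL, ht, ht']
  · intro i; simp [hL, e2]
  · simp [hL, hs, hs']
  · refine natDegree_mul_le.trans ?_
    refine (Nat.add_le_add_right natDegree_mul_le _).trans ?_
    simp only [natDegree_X_sub_C]
    omega
  · simp only [natDegree_X_sub_C]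
    omega
  · simp [hL, ht, sub_eq_zero, htt, hst.symm, hst'.symm]
  · simp [hL]
  · simp [hL, hs, sub_eq_zero, hss]


/-- **Size of the image of the rational curve.** Let `p` be prime, `d ≥ 2`,
`f 1, …, f d, h ∈ 𝔽_p[t]` with `deg (f i) = d`, `deg h = d + 1`, and
`f 1, …, f d, h` linearly independent. Then the image of
`γ(t) = (f_1(t)/h(t), …, f_d(t)/h(t))` on `{t : h(t) ≠ 0}` has cardinality at least
`p - d - 2`. -/
theorem statement13 (p d : ℕ) [Fact p.Prime] (hd : 2 ≤ d)
    (f : Fin d → Polynomial (ZMod p)) (h : Polynomial (ZMod p))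
    (hdegf : ∀ i, (f i).natDegree = d) (hdegh : h.natDegree = d + 1)
    (hind : ∀ (c : Fin d → ZMod p) (b : ZMod p),
      (∑ i, c i • f i) + b • h = 0 → (∀ i, c i = 0) ∧ b = 0) :
    (p : ℤ) - d - 2 ≤
      (Set.ncard ((fun t => fun i : Fin d => (f i).eval t / h.eval t) ''
        {t : ZMod p | h.eval t ≠ 0}) : ℤ) := by
  classical
  set g : ZMod p → Fin d → ZMod p := fun t => fun i : Fin d => (f i).eval t / h.eval t with hg
  let S : Finset (ZMod p) := Finset.univ.filter fun t => h.eval t ≠ 0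
  have hS : {t : ZMod p | h.eval t ≠ 0} = (S : Set (ZMod p)) := by ext; simp [S]
  have hh : h ≠ 0 := by rintro rfl; simp at hdegh
  rw [hS, ← Finset.coe_image, Set.ncard_coe_finset]
  have hcard : p ≤ S.card + (d + 1) := by
    have h1 : (Finset.univ.filter fun t : ZMod p => ¬ h.eval t ≠ 0).card ≤ d + 1 := by
      rw [← hdegh]
      refine le_trans (Finset.card_le_card ?_) (h.roots.toFinset_card_le.trans h.card_roots')
      intro t ht
      simpa [hh] using ht
    have h2 := Finset.card_filter_add_card_filter_not (s := (Finset.univ : Finset (ZMod p)))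
      (fun t => h.eval t ≠ 0)
    rw [Finset.card_univ, ZMod.card] at h2
    change S.card + _ = p at h2
    omega
  suffices S.card ≤ (S.image g).card + 1 by omega
  by_cases hc : Set.InjOn g S
  · rw [Finset.card_image_of_injOn hc]; omega
  · simp only [Set.InjOn, not_forall] at hc
    obtain ⟨t, ht, t', ht', e1, htt⟩ := hc
    have hinj : Set.InjOn g (S.erase t) := by
      intro s hs s' hs' e2
      by_contra hss
      simp only [Finset.coe_erase, Set.mem_diff, Set.mem_singleton_iff] at hs hs'
      exact no_two_collisions d hd f h hdegf hdegh hind t t' s s'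
        (by simpa [S] using ht) (by simpa [S] using ht') (by simpa [S] using hs.1)
        (by simpa [S] using hs'.1) htt hss hs.2 hs'.2 (congrFun e1) (congrFun e2)
    have h1 := Finset.card_le_card (Finset.image_subset_image (f := g) (Finset.erase_subset t S))
    rw [Finset.card_image_of_injOn hinj, Finset.card_erase_of_mem (by simpa using ht)] at h1
    omega
end

section
/- Let d ≥ 2, let p be a prime with p ≡ 1 (mod 4) and p > (d+1)!, and let f_1, …, f_d, g, h ∈ 𝔽_p[t] satisfy the conclusion of the paper's polynomial construction: f_1² + ⋯ + f_d² = g·h; deg f_i = d, deg g = d−1, deg h = d+1; f_1, …, f_d, g, h are linearly independent over 𝔽_p; and the coefficient of t¹ in each of f_1, …, f_d, h is zero. Let m := ⌊(p−1)/(d+1)⌋ and let D := {t ∈ 𝔽_p : t ≠ 0, t^{−1} ∈ {1̄, …, m̄}, h(t) ≠ 0}. Then for every choice of λ_1, …, λ_d, λ ∈ 𝔽_p with (λ_1, …, λ_d) ≠ (0, …, 0), the number of t ∈ D with λ_1·f_1(t)/h(t) + ⋯ + λ_d·f_d(t)/h(t) + λ = 0 is at most d. -/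
open Polynomial in
lemma coeff_one_prod_aux {K : Type*} [Field K] (S : Finset K) (hS : ∀ t ∈ S, t ≠ 0) :
    (∏ t ∈ S, (X - C t)).coeff 1 = -(∏ t ∈ S, (X - C t)).coeff 0 * ∑ t ∈ S, t⁻¹ := by
  classical
  induction S using Finset.induction_on with
  | empty => simp [coeff_one]
  | insert a S ha ih =>
    have ih' := ih (fun t ht => hS t (Finset.mem_insert_of_mem ht))
    have ha0 : a ≠ 0 := hS a (Finset.mem_insert_self _ _)
    rw [Finset.prod_insert ha, Finset.sum_insert ha]
    simp only [sub_mul, coeff_sub, coeff_C_mul, coeff_X_mul, coeff_X_mul_zero, ih']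
    simp
    field_simp

/-- **Hyperplanes meet the restricted curve in at most `d` points.** Let `d ≥ 2`,
`p` a prime with `p ≡ 1 (mod 4)` and `p > (d+1)!`, and `f 1, …, f d, g, h ∈ 𝔽_p[t]`
satisfying the conclusion of Theorem 2.1 (identity, degree, independence, vanish).
Let `m = ⌊(p-1)/(d+1)⌋` and let `D` be the set of `t ∈ 𝔽_p` with `t ≠ 0`,
`t⁻¹ ∈ {1̄, …, m̄}`, and `h(t) ≠ 0`. Then every hyperplane
`{x : λ_1 x_1 + ⋯ + λ_d x_d + λ = 0}` with `(λ_1, …, λ_d) ≠ 0` meets the restricted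
curve `γ̃(t) = (f_i(t)/h(t))_i`, `t ∈ D`, in at most `d` parameter values. -/
theorem statement15 (d p : ℕ) [Fact p.Prime] (hd : 2 ≤ d)
    (hmod : p % 4 = 1) (hbig : (d + 1).factorial < p)
    (f : Fin d → Polynomial (ZMod p)) (g h : Polynomial (ZMod p))
    (hident : (∑ i, (f i) ^ 2) = g * h)
    (hdegf : ∀ i, (f i).natDegree = d) (hdegg : g.natDegree = d - 1)
    (hdegh : h.natDegree = d + 1)
    (hind : ∀ (c : Fin d → ZMod p) (a b : ZMod p),
      (∑ i, c i • f i) + a • g + b • h = 0 → (∀ i, c i = 0) ∧ a = 0 ∧ b = 0)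
    (hvanf : ∀ i, (f i).coeff 1 = 0) (hvanh : h.coeff 1 = 0)
    (lam : Fin d → ZMod p) (c : ZMod p) (hlam : lam ≠ 0) :
    Set.ncard {t : ZMod p | t ≠ 0 ∧
        (∃ k : ℕ, 1 ≤ k ∧ k ≤ (p - 1) / (d + 1) ∧ t⁻¹ = (k : ZMod p)) ∧
        h.eval t ≠ 0 ∧
        (∑ i, lam i * ((f i).eval t / h.eval t)) + c = 0} ≤ d := by
  classical
  by_contra hcon
  push Not at hcon
  obtain ⟨T, hTsub, hTcard⟩ := Set.exists_subset_card_eq (Nat.succ_le_of_lt hcon)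
  have hTfin : T.Finite := Set.toFinite T
  obtain ⟨S, rfl⟩ : ∃ S : Finset (ZMod p), (S : Set (ZMod p)) = T := ⟨hTfin.toFinset, by simp⟩
  rw [Set.ncard_coe_finset] at hTcard
  have hS : ∀ t ∈ S, t ≠ 0 ∧
        (∃ k : ℕ, 1 ≤ k ∧ k ≤ (p - 1) / (d + 1) ∧ t⁻¹ = (k : ZMod p)) ∧
        h.eval t ≠ 0 ∧
        (∑ i, lam i * ((f i).eval t / h.eval t)) + c = 0 := fun t ht => hTsub ht
  set P : Polynomial (ZMod p) := (∑ i, lam i • f i) + c • h with hP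
  have hP0 : P ≠ 0 := by
    intro h0
    apply hlam
    funext i
    exact (hind lam 0 c (by rw [zero_smul, add_zero]; exact h0)).1 i
  have hPdeg : P.natDegree ≤ d + 1 := by
    refine (Polynomial.natDegree_add_le _ _).trans (max_le ?_ ?_)
    · refine Polynomial.natDegree_sum_le_of_forall_le _ _ (fun i _ => ?_)
      exact (Polynomial.natDegree_smul_le _ _).trans (by rw [hdegf]; omega)
    · exact (Polynomial.natDegree_smul_le _ _).trans hdegh.le
  have hP1 : P.coeff 1 = 0 := by
    simp [hP, Polynomial.finsetSum_coeff, hvanf, hvanh]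
  have hroot : ∀ t ∈ S, P.eval t = 0 := by
    intro t ht
    obtain ⟨-, -, hh, he⟩ := hS t ht
    have : P.eval t = h.eval t * ((∑ i, lam i * ((f i).eval t / h.eval t)) + c) := by
      simp only [hP, Polynomial.eval_add, Polynomial.eval_finsetSum, Polynomial.eval_smul,
        smul_eq_mul, mul_add, Finset.mul_sum]
      congr 1
      · refine Finset.sum_congr rfl (fun i _ => ?_)
        field_simp
      · ring
    rw [this, he, mul_zero]
  have hdvd : (∏ t ∈ S, (Polynomial.X - Polynomial.C t)) ∣ P := by
    refine Finset.prod_dvd_of_coprime (fun a _ b _ hab => ?_) (fun t ht => ?_)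
    · exact Polynomial.pairwise_coprime_X_sub_C Function.injective_id hab
    · exact Polynomial.dvd_iff_isRoot.2 (hroot t ht)
  obtain ⟨R, hR⟩ := hdvd
  have hmon : (∏ t ∈ S, (Polynomial.X - Polynomial.C t)).Monic :=
    Polynomial.monic_prod_X_sub_C _ _
  have hQdeg : (∏ t ∈ S, (Polynomial.X - Polynomial.C t)).natDegree = d + 1 := by
    rw [Polynomial.natDegree_finsetProd_X_sub_C_eq_card, hTcard]
  have hR0 : R ≠ 0 := by
    rintro rfl
    exact hP0 (by rw [hR, mul_zero])
  have hRdeg : R.natDegree = 0 := by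
    have := hmon.natDegree_mul' hR0
    rw [← hR, hQdeg] at this
    omega
  obtain ⟨r, rfl⟩ : ∃ r, R = Polynomial.C r := ⟨_, Polynomial.eq_C_of_natDegree_eq_zero hRdeg⟩
  have hr : r ≠ 0 := by
    rintro rfl
    simp at hR0
  rw [hR, Polynomial.coeff_mul_C, coeff_one_prod_aux S (fun t ht => (hS t ht).1)] at hP1
  have hc0 : (∏ t ∈ S, (Polynomial.X - Polynomial.C t)).coeff 0 ≠ 0 := by
    rw [Polynomial.coeff_zero_prod, Finset.prod_ne_zero_iff]
    intro t ht
    simpa using (hS t ht).1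
  have hsum : ∑ t ∈ S, t⁻¹ = 0 := by
    simpa [hr, hc0] using hP1
  choose! k hk1 hk2 hk3 using fun t ht => (hS t ht).2.1
  rw [Finset.sum_congr rfl hk3, ← Nat.cast_sum, ZMod.natCast_eq_zero_iff] at hsum
  have hlow : 0 < ∑ t ∈ S, k t :=
    Finset.sum_pos hk1 (Finset.card_pos.1 (by omega))
  have hup : ∑ t ∈ S, k t ≤ (d + 1) * ((p - 1) / (d + 1)) := by
    have := Finset.sum_le_card_nsmul S k _ hk2
    rwa [hTcard, smul_eq_mul] at this
  have h2 := Nat.mul_div_le (p - 1) (d + 1)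
  have h3 := Nat.le_of_dvd hlow hsum
  have h4 := (Fact.out : p.Prime).pos
  omega
end
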